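/- Under assumptions (A1)-(A4) on f with strongly pseudomonotone constant γ and Lipschitz-type constant L, and with constant parameters λ satisfying 0 < λ < min{4γ²/L², 1/L²} and θ satisfying 0 ≤ θ < min{λ(2γ-L√λ), (1-L√λ)/(3-L√λ+2λ(2γ-L√λ))}, the sequence {xₙ} generated by the inertial algorithm wₙ = xₙ + θ(xₙ - x_{n-1}), x_{n+1} = prox_{λ f(wₙ,·)}(wₙ) satisfies ‖x_{n+1} - x*‖ ≤ M αⁿ for all n ≥ 1, where α = √((1+θ)/(1+λ(2γ-L√λ))) ∈ (0,1) and M = √(‖x₁-x*‖² + B‖x₁-x₀‖²) with B = (1-θ)(1-L√λ)/(1+λ(2γ-L√λ)). -/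

import Mathlib

theorem aux_lim (K c : ℝ) (h : ∀ t : ℝ, 0 < t → t ≤ 1 → K ≤ t * c) : K ≤ 0 := by
  by_contra hK
  push Not at hK
  have h1 := h 1 one_pos le_rfl
  have hc : 0 < c := by linarith
  have h2 := h (K / (2 * c)) (by positivity) (by rw [div_le_one (by positivity)]; linarith)
  have h3 : K / (2 * c) * c = K / 2 := by field_simp
  linarith

theorem aux_prox {H : Type*} [NormedAddCommGroup H] [InnerProductSpace ℝ H]
    (C : Set H) (hCconv : Convex ℝ C) (g : H → ℝ) (hg : ConvexOn ℝ C g)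
    (lam : ℝ) (hlam : 0 < lam) (w p y : H) (hp : p ∈ C) (hy : y ∈ C)
    (h : ∀ y ∈ C, lam * g p + 1 / 2 * ‖w - p‖ ^ 2 ≤ lam * g y + 1 / 2 * ‖w - y‖ ^ 2) :
    lam * g p - lam * g y + inner ℝ (w - p) (y - p) ≤ 0 := by
  apply aux_lim _ (1 / 2 * ‖y - p‖ ^ 2)
  intro t ht ht1
  have hm : (1 - t) • p + t • y ∈ C := hCconv hp hy (by linarith) ht.le (by ring)
  have h1 := h _ hm
  have h2 := hg.2 hp hy (by linarith : 0 ≤ 1 - t) ht.le (by ring)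
  simp only [smul_eq_mul] at h2
  have h3 : w - ((1 - t) • p + t • y) = (w - p) - t • (y - p) := by module
  rw [h3, norm_sub_sq_real (w - p) (t • (y - p)), inner_smul_right, norm_smul, Real.norm_eq_abs, mul_pow, sq_abs] at h1
  have h4 := mul_le_mul_of_nonneg_left h2 hlam.le
  have h5 : t * (lam * g p - lam * g y + inner ℝ (w - p) (y - p)) ≤
      t * (t * (1 / 2 * ‖y - p‖ ^ 2)) := by nlinarith
  exact le_of_mul_le_mul_left h5 ht

theorem aux_norms {H : Type*} [NormedAddCommGroup H] [InnerProductSpace ℝ H]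
    (a b z p : H) (θ : ℝ) (h0 : 0 ≤ θ) :
    ‖(a + θ • (a - b)) - z‖ ^ 2 ≤ (1 + θ) * ‖a - z‖ ^ 2 + θ * (1 + θ) * ‖a - b‖ ^ 2 ∧
    (1 - θ) * ‖p - a‖ ^ 2 - θ * (1 - θ) * ‖a - b‖ ^ 2 ≤ ‖(a + θ • (a - b)) - p‖ ^ 2 := by
  constructor
  · have e1 : (a + θ • (a - b)) - z = (a - z) + θ • (a - b) := by module
    have e2 : b - z = (a - z) - (a - b) := by abel
    have e3 := norm_sub_sq_real (a - z) (a - b)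
    rw [← e2] at e3
    rw [e1, norm_add_sq_real, inner_smul_right, norm_smul, Real.norm_eq_abs, mul_pow, sq_abs]
    nlinarith [mul_nonneg h0 (sq_nonneg ‖b - z‖)]
  · have e1 : (a + θ • (a - b)) - p = θ • (a - b) - (p - a) := by module
    have e3 := norm_sub_sq_real (a - b) (p - a)
    rw [e1, norm_sub_sq_real (θ • (a - b)) (p - a), inner_smul_left, norm_smul, Real.norm_eq_abs, mul_pow, sq_abs]
    simp only [conj_trivial]
    nlinarith [mul_nonneg h0 (sq_nonneg ‖(a - b) - (p - a)‖)]

theorem aux_param (θ s D : ℝ) (h0 : 0 ≤ θ) (hs0 : 0 ≤ s) (hs1 : s < 1) (hD : 0 < D)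
    (h : θ * (3 - s + 2 * D) < 1 - s) :
    θ < 1 ∧ (θ * (1 + θ) + θ * (1 - θ) * (1 - s)) * (1 + D) ≤
      (1 + θ) * ((1 - θ) * (1 - s)) := by
  have h1 : θ < 1 := by
    by_contra hh
    push Not at hh
    nlinarith
  refine ⟨h1, ?_⟩
  have h2 : 2 * (θ * (1 + D)) ≤ (1 - s) * (1 - θ) := by nlinarith
  have h3 : 0 ≤ (1 + θ) + (1 - θ) * (1 - s) := by nlinarith
  have h4 := mul_le_mul_of_nonneg_right h2 h3
  have h5 : (1 + θ) + (1 - θ) * (1 - s) ≤ 2 * (1 + θ) := by nlinarith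
  have h6 : 0 ≤ (1 - s) * (1 - θ) := by nlinarith
  have h7 := mul_le_mul_of_nonneg_left h5 h6
  nlinarith

/-- Linear convergence of the inertial regularized algorithm with known constants
(Theorem 2). -/
theorem inertial_algorithm_linear_convergence
    {H : Type*} [NormedAddCommGroup H] [InnerProductSpace ℝ H] [CompleteSpace H]
    (C : Set H) (hCne : C.Nonempty) (hCclosed : IsClosed C) (hCconv : Convex ℝ C)
    (f : H → H → ℝ) (γ L : ℝ) (hγ : 0 < γ) (hL : 0 < L)
    (hA1 : ∀ x ∈ C, f x x = 0)
    (hA2 : ∀ x ∈ C, ∀ y ∈ C, 0 ≤ f x y → f y x ≤ -γ * ‖x - y‖ ^ 2)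
    (hA3 : ∀ x y z : H, f x y + f y z ≥ f x z - L * ‖x - y‖ * ‖y - z‖)
    (hA4 : ∀ x : H, ConvexOn ℝ C (f x) ∧ LowerSemicontinuousOn (f x) C)
    (xstar : H) (hxstarC : xstar ∈ C) (hsol : ∀ y ∈ C, 0 ≤ f xstar y)
    (lam θ : ℝ)
    (hlam : 0 < lam ∧ lam < min (4 * γ ^ 2 / L ^ 2) (1 / L ^ 2))
    (hθ : 0 ≤ θ ∧ θ < min (lam * (2 * γ - L * Real.sqrt lam))
      ((1 - L * Real.sqrt lam) /
        (3 - L * Real.sqrt lam + 2 * lam * (2 * γ - L * Real.sqrt lam))))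
    (x : ℕ → H) (hxC : ∀ n, x n ∈ C)
    (hstep : ∀ n, 1 ≤ n →
      ∀ y ∈ C,
        lam * f (x n + θ • (x n - x (n - 1))) (x (n + 1)) +
            1 / 2 * ‖(x n + θ • (x n - x (n - 1))) - x (n + 1)‖ ^ 2 ≤
          lam * f (x n + θ • (x n - x (n - 1))) y +
            1 / 2 * ‖(x n + θ • (x n - x (n - 1))) - y‖ ^ 2) :
    (0 < Real.sqrt ((1 + θ) / (1 + lam * (2 * γ - L * Real.sqrt lam))) ∧
      Real.sqrt ((1 + θ) / (1 + lam * (2 * γ - L * Real.sqrt lam))) < 1) ∧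
    ∀ n, 1 ≤ n →
      ‖x (n + 1) - xstar‖ ≤
        Real.sqrt (‖x 1 - xstar‖ ^ 2 +
            ((1 - θ) * (1 - L * Real.sqrt lam) / (1 + lam * (2 * γ - L * Real.sqrt lam))) *
              ‖x 1 - x 0‖ ^ 2) *
          Real.sqrt ((1 + θ) / (1 + lam * (2 * γ - L * Real.sqrt lam))) ^ n := by
  obtain ⟨hl0, hl⟩ := hlam
  obtain ⟨hl1, hl2⟩ := lt_min_iff.1 hl
  obtain ⟨ht0, ht⟩ := hθ
  obtain ⟨ht1, ht2⟩ := lt_min_iff.1 ht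
  obtain ⟨r, hr⟩ : ∃ r, r = Real.sqrt lam := ⟨_, rfl⟩
  have hr0 : 0 < r := hr ▸ Real.sqrt_pos.2 hl0
  have hrr : r ^ 2 = lam := hr ▸ Real.sq_sqrt hl0.le
  rw [← hr] at ht1 ht2 ⊢
  obtain ⟨s, hs⟩ : ∃ s, s = L * r := ⟨_, rfl⟩
  rw [← hs] at ht1 ht2 ⊢
  have hs0 : 0 < s := hs ▸ mul_pos hL hr0
  have hss : s ^ 2 = lam * L ^ 2 := by rw [hs, mul_pow, hrr]; ring
  rw [lt_div_iff₀ (by positivity)] at hl1 hl2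
  have hs1 : s < 1 := by nlinarith
  have hs2 : s < 2 * γ := by nlinarith
  have hD0 : 0 < lam * (2 * γ - s) := mul_pos hl0 (by linarith)
  rw [show 2 * lam * (2 * γ - s) = 2 * (lam * (2 * γ - s)) by ring] at ht2
  obtain ⟨D, hD⟩ : ∃ D, D = lam * (2 * γ - s) := ⟨_, rfl⟩
  rw [← hD] at ht1 ht2 hD0 ⊢
  rw [lt_div_iff₀ (by linarith)] at ht2
  obtain ⟨hθ1, hpar⟩ := aux_param θ s D ht0 hs0.le hs1 hD0 ht2
  have hD1 : 0 < 1 + D := by linarith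
  obtain ⟨q, hq⟩ : ∃ q, q = (1 + θ) / (1 + D) := ⟨_, rfl⟩
  obtain ⟨B, hB⟩ : ∃ B, B = (1 - θ) * (1 - s) / (1 + D) := ⟨_, rfl⟩
  have hq0 : 0 < q := hq ▸ div_pos (by linarith) hD1
  have hq1 : q < 1 := by rw [hq, div_lt_one hD1]; linarith
  have hB0 : 0 ≤ B := hB ▸ div_nonneg (mul_nonneg (by linarith) (by linarith)) hD1.le
  have hqD : q * (1 + D) = 1 + θ := by rw [hq]; field_simp
  have hBD : B * (1 + D) = (1 - θ) * (1 - s) := by rw [hB]; field_simp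
  rw [← hq, ← hB]
  refine ⟨⟨Real.sqrt_pos.2 hq0, ?_⟩, ?_⟩
  · rw [Real.sqrt_lt' one_pos]; linarith
  have key : ∀ n, 1 ≤ n → ‖x (n + 1) - xstar‖ ^ 2 + B * ‖x (n + 1) - x n‖ ^ 2 ≤
      q * (‖x n - xstar‖ ^ 2 + B * ‖x n - x (n - 1)‖ ^ 2) := by
    intro n hn
    obtain ⟨n1, n2⟩ := aux_norms (x n) (x (n - 1)) xstar (x (n + 1)) θ ht0
    have h1 := hstep n hn
    generalize x n + θ • (x n - x (n - 1)) = w at n1 n2 h1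
    have hpC := hxC (n + 1)
    have h2 := aux_prox C hCconv (f w) (hA4 w).1 lam hl0 w _ xstar hpC hxstarC h1
    have h3 := hA3 w (x (n + 1)) xstar
    have h4 := hA2 xstar hxstarC _ hpC (hsol _ hpC)
    rw [norm_sub_rev] at h4
    have h5 : w - xstar = (w - x (n + 1)) - (xstar - x (n + 1)) := by abel
    have h6 := norm_sub_sq_real (w - x (n + 1)) (xstar - x (n + 1))
    rw [← h5, norm_sub_rev xstar] at h6
    generalize ‖x (n + 1) - xstar‖ = a at *
    generalize ‖w - x (n + 1)‖ = b at *
    have h7 : 2 * lam * L * b * a ≤ s * b ^ 2 + lam * s * a ^ 2 := by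
      have : 0 ≤ s * (b - r * a) ^ 2 := mul_nonneg hs0.le (sq_nonneg _)
      have e : s * (b - r * a) ^ 2 = s * b ^ 2 + lam * s * a ^ 2 - 2 * lam * L * b * a := by
        rw [← hrr, hs]; ring
      linarith
    have h8 : lam * (f w xstar - L * b * a + γ * a ^ 2) ≤ lam * f w (x (n + 1)) :=
      mul_le_mul_of_nonneg_left (by linarith) hl0.le
    have h9 : (1 + D) * a ^ 2 + (1 - s) * b ^ 2 ≤ ‖w - xstar‖ ^ 2 := by
      rw [hD]; nlinarith
    have h10 := mul_le_mul_of_nonneg_left n2 (by linarith : 0 ≤ 1 - s)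
    have h11 : (θ * (1 + θ) + θ * (1 - θ) * (1 - s)) ≤ (1 + θ) * B := by
      rw [← mul_le_mul_iff_left₀ hD1]
      calc _ ≤ _ := hpar
        _ = _ := by rw [← hBD]; ring
    have h12 := mul_le_mul_of_nonneg_right h11 (sq_nonneg ‖x n - x (n - 1)‖)
    rw [← mul_le_mul_iff_right₀ hD1]
    have e1 : (1 + D) * (a ^ 2 + B * ‖x (n + 1) - x n‖ ^ 2) =
        (1 + D) * a ^ 2 + (1 - θ) * (1 - s) * ‖x (n + 1) - x n‖ ^ 2 := by
      rw [← hBD]; ring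
    have e2 : (1 + D) * (q * (‖x n - xstar‖ ^ 2 + B * ‖x n - x (n - 1)‖ ^ 2)) =
        (1 + θ) * ‖x n - xstar‖ ^ 2 + (1 + θ) * B * ‖x n - x (n - 1)‖ ^ 2 := by
      rw [← hqD]; ring
    rw [e1, e2]
    linarith
  have ind : ∀ n, ‖x (n + 1) - xstar‖ ^ 2 + B * ‖x (n + 1) - x n‖ ^ 2 ≤
      (‖x 1 - xstar‖ ^ 2 + B * ‖x 1 - x 0‖ ^ 2) * q ^ n := by
    intro n
    induction n with
    | zero => simp
    | succ k ih =>
      have h1 := key (k + 1) (by omega)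
      simp only [Nat.add_sub_cancel] at h1
      have h2 := mul_le_mul_of_nonneg_left ih hq0.le
      rw [pow_succ q]
      linarith
  intro n hn
  have hM : 0 ≤ ‖x 1 - xstar‖ ^ 2 + B * ‖x 1 - x 0‖ ^ 2 := by positivity
  refine abs_le_of_sq_le_sq' ?_ (by positivity) |>.2
  rw [mul_pow, Real.sq_sqrt hM, ← pow_mul, mul_comm n 2, pow_mul, Real.sq_sqrt hq0.le]
  have : 0 ≤ B * ‖x (n + 1) - x n‖ ^ 2 := by positivity
  linarith [ind n]
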